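/- There exists an ⟨88,88,88;252770⟩-algorithm over ℚ, obtained by composing a ⟨2,2,2;7⟩-algorithm with a ⟨44,44,44;36110⟩-algorithm (note 7·36110 = 252770); in particular 252770 is strictly smaller than the 257100 multiplications used by the TA-New25 algorithm with base case 88. -/

import Mathlib

open Matrix

/-- Row-major vectorization: `vec A (n*i+j) = A i j`. -/
def vec {F : Type*} {m n : ℕ} (A : Matrix (Fin m) (Fin n) F) : Fin (m * n) → F :=
  fun r => A r.divNat r.modNat

/-- `⟨U, V, W⟩` is an `⟨m, n, p; t⟩`-algorithm over `F`: for all `A, B, C` of the appropriate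
sizes, `trace (A * B * C) = ∑ r, (U ⬝ᵥ vec A) r * (V ⬝ᵥ vec B) r * (W ⬝ᵥ vec C) r`. -/
def IsMMAlg {F : Type*} [Field F] (m n p t : ℕ)
    (U : Matrix (Fin t) (Fin (m * n)) F)
    (V : Matrix (Fin t) (Fin (n * p)) F)
    (W : Matrix (Fin t) (Fin (p * m)) F) : Prop :=
  ∀ (A : Matrix (Fin m) (Fin n) F) (B : Matrix (Fin n) (Fin p) F) (C : Matrix (Fin p) (Fin m) F),
    (A * B * C).trace =
      ∑ r : Fin t, U.mulVec (vec A) r * V.mulVec (vec B) r * W.mulVec (vec C) r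

/-! ### Trilinear rank -/

section Rank

variable {M₁ M₂ M₃ N₁ N₂ N₃ : Type*}
  [AddCommGroup M₁] [Module ℚ M₁] [AddCommGroup M₂] [Module ℚ M₂] [AddCommGroup M₃] [Module ℚ M₃]
  [AddCommGroup N₁] [Module ℚ N₁] [AddCommGroup N₂] [Module ℚ N₂] [AddCommGroup N₃] [Module ℚ N₃]

/-- `T` is a sum of `t` products of three linear forms. -/
def Rk (T : M₁ → M₂ → M₃ → ℚ) (t : ℕ) : Prop :=
  ∃ (f : Fin t → M₁ →ₗ[ℚ] ℚ) (g : Fin t → M₂ →ₗ[ℚ] ℚ) (h : Fin t → M₃ →ₗ[ℚ] ℚ),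
    ∀ x y z, T x y z = ∑ r, f r x * g r y * h r z

theorem Rk.of_fintype {ι : Type*} [Fintype ι] {T : M₁ → M₂ → M₃ → ℚ} {t : ℕ}
    (hc : Fintype.card ι = t)
    (f : ι → M₁ →ₗ[ℚ] ℚ) (g : ι → M₂ →ₗ[ℚ] ℚ) (h : ι → M₃ →ₗ[ℚ] ℚ)
    (H : ∀ x y z, T x y z = ∑ r, f r x * g r y * h r z) : Rk T t := by
  let e : Fin t ≃ ι := (Fintype.equivFinOfCardEq hc).symm
  refine ⟨fun r => f (e r), fun r => g (e r), fun r => h (e r), fun x y z => ?_⟩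
  rw [H, ← e.sum_comp]

theorem Rk.add {T T' : M₁ → M₂ → M₃ → ℚ} {t t' : ℕ} (h1 : Rk T t) (h2 : Rk T' t') :
    Rk (fun x y z => T x y z + T' x y z) (t + t') := by
  obtain ⟨f, g, h, H⟩ := h1
  obtain ⟨f', g', h', H'⟩ := h2
  refine Rk.of_fintype (ι := Fin t ⊕ Fin t') (by simp) (Sum.elim f f') (Sum.elim g g')
    (Sum.elim h h') (fun x y z => ?_)
  simp [H, H']

theorem Rk.sum {ι : Type*} (s : Finset ι) {T : ι → M₁ → M₂ → M₃ → ℚ} {n : ℕ}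
    (H : ∀ i ∈ s, Rk (T i) n) : Rk (fun x y z => ∑ i ∈ s, T i x y z) (s.card * n) := by
  classical
  induction s using Finset.induction_on with
  | empty =>
    refine Rk.of_fintype (ι := Fin 0) (by simp) 0 0 0 (fun x y z => by simp)
  | insert a s ha ih =>
    have h1 := (H a (by simp)).add (ih (fun i hi => H i (by simp [hi])))
    rw [Finset.card_insert_of_notMem ha, add_mul, one_mul, add_comm]
    simpa only [Finset.sum_insert ha] using h1

theorem Rk.comp {T : N₁ → N₂ → N₃ → ℚ} {t : ℕ} (H : Rk T t)
    (L₁ : M₁ →ₗ[ℚ] N₁) (L₂ : M₂ →ₗ[ℚ] N₂) (L₃ : M₃ →ₗ[ℚ] N₃) :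
    Rk (fun x y z => T (L₁ x) (L₂ y) (L₃ z)) t := by
  obtain ⟨f, g, h, H⟩ := H
  exact ⟨fun r => f r ∘ₗ L₁, fun r => g r ∘ₗ L₂, fun r => h r ∘ₗ L₃, fun x y z => by simp [H]⟩

theorem Rk.congr {T T' : M₁ → M₂ → M₃ → ℚ} {t : ℕ} (H : Rk T t)
    (h : ∀ x y z, T' x y z = T x y z) : Rk T' t := by
  have : T' = T := by funext x y z; exact h x y z
  rwa [this]

theorem Rk.one (f : M₁ →ₗ[ℚ] ℚ) (g : M₂ →ₗ[ℚ] ℚ) (h : M₃ →ₗ[ℚ] ℚ) :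
    Rk (fun x y z => f x * g y * h z) 1 :=
  ⟨fun _ => f, fun _ => g, fun _ => h, fun x y z => by simp⟩

end Rank

/-! ### Small tensors -/

/-- `2 × 2` arrays. -/
abbrev Q2 := Fin 2 → Fin 2 → ℚ

/-- The linear form on `Q2` with given coefficients. -/
def lf (v : Fin 4 → ℚ) : Q2 →ₗ[ℚ] ℚ where
  toFun a := v 0 * a 0 0 + v 1 * a 0 1 + v 2 * a 1 0 + v 3 * a 1 1
  map_add' a b := by simp; ring
  map_smul' r a := by simp; ring

theorem strassen : Rk (fun a b c : Q2 => ∑ x, ∑ y, ∑ z, a x y * b y z * c z x) 7 := by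
  refine ⟨
    fun r => lf ((![![1, 0, 0, 1], ![0, 0, 1, 1], ![1, 0, 0, 0], ![0, 0, 0, 1],
      ![1, 1, 0, 0], ![-1, 0, 1, 0], ![0, 1, 0, -1]] : Fin 7 → Fin 4 → ℚ) r),
    fun r => lf ((![![1, 0, 0, 1], ![1, 0, 0, 0], ![0, 1, 0, -1], ![-1, 0, 1, 0],
      ![0, 0, 0, 1], ![1, 1, 0, 0], ![0, 0, 1, 1]] : Fin 7 → Fin 4 → ℚ) r),
    fun r => lf ((![![1, 0, 0, 1], ![0, 1, 0, -1], ![0, 0, 1, 1], ![1, 1, 0, 0],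
      ![-1, 0, 1, 0], ![0, 0, 0, 1], ![1, 0, 0, 0]] : Fin 7 → Fin 4 → ℚ) r),
    fun a b c => ?_⟩
  simp [lf, Fin.sum_univ_succ]
  ring

/-- The correction tensor, equivalent to `2 × 2` matrix multiplication. -/
def corr (a b c : Q2) : ℚ :=
  ∑ x : Fin 2, ∑ y : Fin 2, ∑ z : Fin 2,
    ((-1) ^ (z : ℕ) * (-1) ^ (x : ℕ)) * (a x y * b z x * c y z)

theorem rk_corr (s : ℚ) : Rk (fun a b c : Q2 => s * corr a b c) 7 := by
  refine ⟨
    fun r => s • lf ((![![1, 0, 0, 1], ![0, 0, 1, 1], ![1, 0, 0, 0], ![0, 0, 0, 1],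
      ![1, 1, 0, 0], ![-1, 0, 1, 0], ![0, 1, 0, -1]] : Fin 7 → Fin 4 → ℚ) r),
    fun r => lf ((![![1, 0, 0, 1], ![0, -1, 0, -1], ![0, 0, -1, 1], ![1, -1, 0, 0],
      ![-1, 0, -1, 0], ![0, 0, 0, 1], ![1, 0, 0, 0]] : Fin 7 → Fin 4 → ℚ) r),
    fun r => lf ((![![1, 0, 0, 1], ![1, 0, 0, 0], ![0, 1, 0, -1], ![-1, 0, 1, 0],
      ![0, 0, 0, 1], ![1, 1, 0, 0], ![0, 0, 1, 1]] : Fin 7 → Fin 4 → ℚ) r),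
    fun a b c => ?_⟩
  simp [corr, lf, Fin.sum_univ_succ]
  ring

/-- The aggregate, from the values at the positions `ij`, `jk`, `ki`. -/
def agg (x y z : Fin 2) (a₁ a₂ a₃ b₁ b₂ b₃ c₁ c₂ c₃ : Q2) : ℚ :=
  ((-1) ^ (z : ℕ) * a₁ x y + (-1) ^ (y : ℕ) * a₂ z x + (-1) ^ (x : ℕ) * a₃ y z) *
  ((-1) ^ (z : ℕ) * b₂ y z + (-1) ^ (y : ℕ) * b₃ x y + (-1) ^ (x : ℕ) * b₁ z x) *
  (c₃ z x + c₁ y z + c₂ x y)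

theorem rk_diag : Rk (fun a b c : Q2 =>
    (1 / 3) * (∑ x, ∑ y, ∑ z, agg x y z a a a b b b c c c) + (-23) * corr a b c) 8 := by
  refine ⟨
    fun r => ((![1 / 759, 1 / 2346, 1 / 1518, -1 / 1173, -1 / 2346, 1 / 759, 1 / 1518, 1 / 1173] : Fin 8 → ℚ) r) • lf ((![![13, -13, 10, -7],
    ![17, -23, 23, -17],
    ![59, -37, 9, -3],
    ![34, -20, 3, 0],
    ![11, -11, -103, 79],
    ![4, -4, -50, 35],
    ![3, -3, 89, -37],
    ![3, -3, 43, -14]] : Fin 8 → Fin 4 → ℚ) r),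
    fun r => lf ((![![6, -6, -109, 5],
    ![79, -11, 103, -11],
    ![5, 6, 109, 6],
    ![14, 3, 43, 3],
    ![17, 23, 23, 17],
    ![17, 23, 0, -6],
    ![6, 23, 0, -17],
    ![0, 20, 3, 34]] : Fin 8 → Fin 4 → ℚ) r),
    fun r => lf ((![![17, 17, 40, 28],
    ![14, -3, 43, -3],
    ![28, 17, 40, 17],
    ![79, 11, 103, 11],
    ![0, 20, -3, 34],
    ![17, 17, 40, 28],
    ![28, 17, 40, 17],
    ![17, -23, 23, -17]] : Fin 8 → Fin 4 → ℚ) r),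
    fun a b c => ?_⟩
  simp [agg, corr, lf, Fin.sum_univ_succ]
  ring

/-! ### Aggregation -/

section Aggregation

variable {n : ℕ}

/-- Zero row and column sums. -/
def ZS (A : Matrix (Fin n) (Fin n) ℚ) : Prop :=
  (∀ i, ∑ j, A i j = 0) ∧ (∀ j, ∑ i, A i j = 0)

theorem ZS.smul {A : Matrix (Fin n) (Fin n) ℚ} (h : ZS A) (s : ℚ) : ZS (s • A) := by
  constructor
  · intro i; simp [← Finset.mul_sum, h.1 i]
  · intro j; simp [← Finset.mul_sum, h.2 j]

theorem sum_cyc (f : Fin n → Fin n → Fin n → ℚ) :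
    ∑ i, ∑ j, ∑ k, f j k i = ∑ i, ∑ j, ∑ k, f i j k := by
  calc ∑ i, ∑ j, ∑ k, f j k i = ∑ j, ∑ i, ∑ k, f j k i := Finset.sum_comm
    _ = ∑ j, ∑ k, ∑ i, f j k i := Finset.sum_congr rfl fun j _ => Finset.sum_comm

theorem zs_cancel {C : Matrix (Fin n) (Fin n) ℚ} (h : ZS C) (p q : Fin n → Fin n → ℚ) :
    ∑ i, ∑ j, ∑ k, (p i j + q j k) * C k i = 0 := by
  have h1 : ∑ i, ∑ j, ∑ k, p i j * C k i = 0 := by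
    simp [← Finset.mul_sum, h.2]
  have h2 : ∑ i, ∑ j, ∑ k, q j k * C k i = 0 := by
    rw [← sum_cyc (fun j i k => q i k * C k j), ← sum_cyc]
    simp [← Finset.mul_sum, h.1]
  simp only [add_mul, Finset.sum_add_distrib, h1, h2, add_zero]

theorem zs_cancel' {C : Matrix (Fin n) (Fin n) ℚ} (h : ZS C) (p q : Fin n → Fin n → ℚ) :
    ∑ i, ∑ j, ∑ k, (p j k + q k i) * C i j = 0 := by
  rw [sum_cyc (fun i j k => (p i j + q j k) * C k i)]
  exact zs_cancel h p q

theorem zs_cancel'' {C : Matrix (Fin n) (Fin n) ℚ} (h : ZS C) (p q : Fin n → Fin n → ℚ) :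
    ∑ i, ∑ j, ∑ k, (p k i + q i j) * C j k = 0 := by
  rw [← sum_cyc (fun i j k => (p k i + q i j) * C j k)]
  exact zs_cancel h p q

/-- `trace (A B C)`. -/
def tD (A B C : Matrix (Fin n) (Fin n) ℚ) : ℚ := ∑ i, ∑ j, ∑ k, A i j * B j k * C k i

/-- The wrong-order terms. -/
def tE (A B C : Matrix (Fin n) (Fin n) ℚ) : ℚ := ∑ i, ∑ j, ∑ k, A i j * B k i * C j k

/-- The Hadamard terms. -/
def tH (A B C : Matrix (Fin n) (Fin n) ℚ) : ℚ := ∑ i, ∑ j, A i j * B i j * C i j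

theorem agg_sum {A₁ A₂ A₃ B₁ B₂ B₃ C₁ C₂ C₃ : Matrix (Fin n) (Fin n) ℚ}
    (hA₁ : ZS A₁) (hA₂ : ZS A₂) (hA₃ : ZS A₃) (hB₁ : ZS B₁) (hB₂ : ZS B₂) (hB₃ : ZS B₃)
    (hC₁ : ZS C₁) (hC₂ : ZS C₂) (hC₃ : ZS C₃) :
    ∑ i, ∑ j, ∑ k, (A₁ i j + A₂ j k + A₃ k i) * (B₁ j k + B₂ k i + B₃ i j) *
      (C₁ k i + C₂ i j + C₃ j k) =
    tD A₁ B₁ C₁ + tD A₂ B₂ C₂ + tD A₃ B₃ C₃ +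
    (tE A₁ B₂ C₃ + tE A₂ B₃ C₁ + tE A₃ B₁ C₂) +
    n * (tH A₁ B₃ C₂ + tH A₂ B₁ C₃ + tH A₃ B₂ C₁) := by
  have e : ∀ i j k : Fin n, (A₁ i j + A₂ j k + A₃ k i) * (B₁ j k + B₂ k i + B₃ i j) *
      (C₁ k i + C₂ i j + C₃ j k) =
      A₁ i j * B₁ j k * C₁ k i + A₂ j k * B₂ k i * C₂ i j + A₃ k i * B₃ i j * C₃ j k +
      (A₁ i j * B₂ k i * C₃ j k + A₂ j k * B₃ i j * C₁ k i + A₃ k i * B₁ j k * C₂ i j) +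
      (A₁ i j * B₃ i j * C₂ i j + A₂ j k * B₁ j k * C₃ j k + A₃ k i * B₂ k i * C₁ k i) +
      ((A₁ i j * B₃ i j + A₂ j k * B₁ j k) * C₁ k i +
       (A₂ j k * B₁ j k + A₃ k i * B₂ k i) * C₂ i j +
       (A₃ k i * B₂ k i + A₁ i j * B₃ i j) * C₃ j k) +
      ((A₃ k i * C₁ k i + A₁ i j * C₂ i j) * B₁ j k +
       (A₁ i j * C₂ i j + A₂ j k * C₃ j k) * B₂ k i +
       (A₂ j k * C₃ j k + A₃ k i * C₁ k i) * B₃ i j) +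
      ((B₁ j k * C₃ j k + B₂ k i * C₁ k i) * A₁ i j +
       (B₂ k i * C₁ k i + B₃ i j * C₂ i j) * A₂ j k +
       (B₃ i j * C₂ i j + B₁ j k * C₃ j k) * A₃ k i) := by
    intro i j k; ring
  have d2 : ∑ i, ∑ j, ∑ k, A₂ j k * B₂ k i * C₂ i j = tD A₂ B₂ C₂ :=
    sum_cyc (fun i j k => A₂ i j * B₂ j k * C₂ k i)
  have d3 : ∑ i, ∑ j, ∑ k, A₃ k i * B₃ i j * C₃ j k = tD A₃ B₃ C₃ := by
    rw [← sum_cyc (fun i j k => A₃ k i * B₃ i j * C₃ j k)]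
    rfl
  have e2 : ∑ i, ∑ j, ∑ k, A₂ j k * B₃ i j * C₁ k i = tE A₂ B₃ C₁ :=
    sum_cyc (fun i j k => A₂ i j * B₃ k i * C₁ j k)
  have e3 : ∑ i, ∑ j, ∑ k, A₃ k i * B₁ j k * C₂ i j = tE A₃ B₁ C₂ := by
    rw [← sum_cyc (fun i j k => A₃ k i * B₁ j k * C₂ i j)]
    rfl
  have h0 : ∀ A B C : Matrix (Fin n) (Fin n) ℚ,
      ∑ i, ∑ j, ∑ _k : Fin n, A i j * B i j * C i j = n * tH A B C := by
    intro A B C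
    simp [tH, Finset.mul_sum]
  have h2 : ∑ i : Fin n, ∑ j, ∑ k, A₂ j k * B₁ j k * C₃ j k = n * tH A₂ B₁ C₃ := by
    rw [← h0]
    exact sum_cyc (fun i j _ => A₂ i j * B₁ i j * C₃ i j)
  have h3 : ∑ i, ∑ j : Fin n, ∑ k, A₃ k i * B₂ k i * C₁ k i = n * tH A₃ B₂ C₁ := by
    rw [← h0, ← sum_cyc (fun i _ k => A₃ k i * B₂ k i * C₁ k i)]
  simp only [e, Finset.sum_add_distrib]
  rw [d2, d3, e2, e3, h0, h2, h3,
    zs_cancel hC₁ (fun i j => A₁ i j * B₃ i j) (fun j k => A₂ j k * B₁ j k),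
    zs_cancel' hC₂ (fun j k => A₂ j k * B₁ j k) (fun k i => A₃ k i * B₂ k i),
    zs_cancel'' hC₃ (fun k i => A₃ k i * B₂ k i) (fun i j => A₁ i j * B₃ i j),
    zs_cancel'' hB₁ (fun k i => A₃ k i * C₁ k i) (fun i j => A₁ i j * C₂ i j),
    zs_cancel hB₂ (fun i j => A₁ i j * C₂ i j) (fun j k => A₂ j k * C₃ j k),
    zs_cancel' hB₃ (fun j k => A₂ j k * C₃ j k) (fun k i => A₃ k i * C₁ k i),
    zs_cancel' hA₁ (fun j k => B₁ j k * C₃ j k) (fun k i => B₂ k i * C₁ k i),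
    zs_cancel'' hA₂ (fun k i => B₂ k i * C₁ k i) (fun i j => B₃ i j * C₂ i j),
    zs_cancel hA₃ (fun i j => B₃ i j * C₂ i j) (fun j k => B₁ j k * C₃ j k)]
  simp only [tD, tE]
  ring

theorem tD_smul (s t : ℚ) (A B C : Matrix (Fin n) (Fin n) ℚ) :
    tD (s • A) (t • B) C = s * t * tD A B C := by
  simp only [tD, Finset.mul_sum, Matrix.smul_apply, smul_eq_mul]
  refine Finset.sum_congr rfl fun i _ => Finset.sum_congr rfl fun j _ =>
    Finset.sum_congr rfl fun k _ => by ring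

theorem tE_smul (s t : ℚ) (A B C : Matrix (Fin n) (Fin n) ℚ) :
    tE (s • A) (t • B) C = s * t * tE A B C := by
  simp only [tE, Finset.mul_sum, Matrix.smul_apply, smul_eq_mul]
  refine Finset.sum_congr rfl fun i _ => Finset.sum_congr rfl fun j _ =>
    Finset.sum_congr rfl fun k _ => by ring

theorem tH_smul (s t : ℚ) (A B C : Matrix (Fin n) (Fin n) ℚ) :
    tH (s • A) (t • B) C = s * t * tH A B C := by
  simp only [tH, Finset.mul_sum, Matrix.smul_apply, smul_eq_mul]
  refine Finset.sum_congr rfl fun i _ => Finset.sum_congr rfl fun j _ => by ring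

/-- `2 × 2` arrays of square blocks. -/
abbrev Blk (n : ℕ) := Fin 2 → Fin 2 → Matrix (Fin n) (Fin n) ℚ

/-- The `2 × 2` array of entries at position `i, j`. -/
def ent (i j : Fin n) : Blk n →ₗ[ℚ] Q2 where
  toFun a := fun x y => a x y i j
  map_add' a b := by ext x y; simp
  map_smul' r a := by ext x y; simp

/-- The sum of the eight aggregates at `i, j, k`. -/
def agg8 (a b c : Blk n) (i j k : Fin n) : ℚ :=
  ∑ x, ∑ y, ∑ z, agg x y z (ent i j a) (ent j k a) (ent k i a)
    (ent i j b) (ent j k b) (ent k i b) (ent i j c) (ent j k c) (ent k i c)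

theorem agg_one (a b c : Blk n) (ha : ∀ x y, ZS (a x y)) (hb : ∀ x y, ZS (b x y))
    (hc : ∀ x y, ZS (c x y)) (x y z : Fin 2) :
    ∑ i, ∑ j, ∑ k, agg x y z (ent i j a) (ent j k a) (ent k i a)
      (ent i j b) (ent j k b) (ent k i b) (ent i j c) (ent j k c) (ent k i c) =
    ((-1) ^ (z : ℕ) * (-1) ^ (z : ℕ)) * tD (a x y) (b y z) (c z x) +
    ((-1) ^ (y : ℕ) * (-1) ^ (y : ℕ)) * tD (a z x) (b x y) (c y z) +
    ((-1) ^ (x : ℕ) * (-1) ^ (x : ℕ)) * tD (a y z) (b z x) (c x y) +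
    (((-1) ^ (z : ℕ) * (-1) ^ (y : ℕ)) * tE (a x y) (b x y) (c x y) +
     ((-1) ^ (y : ℕ) * (-1) ^ (x : ℕ)) * tE (a z x) (b z x) (c z x) +
     ((-1) ^ (x : ℕ) * (-1) ^ (z : ℕ)) * tE (a y z) (b y z) (c y z)) +
    n * (((-1) ^ (z : ℕ) * (-1) ^ (x : ℕ)) * tH (a x y) (b z x) (c y z) +
     ((-1) ^ (y : ℕ) * (-1) ^ (z : ℕ)) * tH (a z x) (b y z) (c x y) +
     ((-1) ^ (x : ℕ) * (-1) ^ (y : ℕ)) * tH (a y z) (b x y) (c z x)) := by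
  have := agg_sum ((ha x y).smul ((-1) ^ (z : ℕ))) ((ha z x).smul ((-1) ^ (y : ℕ)))
    ((ha y z).smul ((-1) ^ (x : ℕ))) ((hb y z).smul ((-1) ^ (z : ℕ)))
    ((hb x y).smul ((-1) ^ (y : ℕ))) ((hb z x).smul ((-1) ^ (x : ℕ)))
    (hc z x) (hc y z) (hc x y)
  simp only [tD_smul, tE_smul, tH_smul] at this
  rw [← this]
  rfl

theorem sum_comm_many (f : Fin n → Fin n → Fin n → Fin 2 → Fin 2 → Fin 2 → ℚ) :
    ∑ i, ∑ j, ∑ k, ∑ x, ∑ y, ∑ z, f i j k x y z =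
    ∑ x, ∑ y, ∑ z, ∑ i, ∑ j, ∑ k, f i j k x y z := by
  simp only [Fin.sum_univ_two, Finset.sum_add_distrib]

theorem corr_sum (a b c : Blk n) :
    ∑ i, ∑ j, corr (ent i j a) (ent i j b) (ent i j c) =
    ∑ x : Fin 2, ∑ y : Fin 2, ∑ z : Fin 2,
      ((-1) ^ (z : ℕ) * (-1) ^ (x : ℕ)) * tH (a x y) (b z x) (c y z) := by
  simp only [corr, Fin.sum_univ_two, Finset.sum_add_distrib, tH, Finset.mul_sum, ent,
    LinearMap.coe_mk, AddHom.coe_mk]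

theorem agg_main (a b c : Blk n) (ha : ∀ x y, ZS (a x y)) (hb : ∀ x y, ZS (b x y))
    (hc : ∀ x y, ZS (c x y)) :
    ∑ x, ∑ y, ∑ z, tD (a x y) (b y z) (c z x) =
      (1 / 3) * (∑ i, ∑ j, ∑ k, agg8 a b c i j k) -
      n * ∑ i, ∑ j, corr (ent i j a) (ent i j b) (ent i j c) := by
  rw [corr_sum]
  simp only [agg8]
  rw [sum_comm_many]
  simp only [agg_one a b c ha hb hc]
  simp [Fin.sum_univ_two]
  ring

theorem agg8_cyc (a b c : Blk n) (i j k : Fin n) : agg8 a b c j k i = agg8 a b c i j k := by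
  simp only [agg8, agg, Fin.sum_univ_two]
  ring

/-- The chosen representatives of cyclic orbits. -/
def isRep (i j k : Fin n) : Prop := i ≤ j ∧ i < k

instance (i j k : Fin n) : Decidable (isRep i j k) := by unfold isRep; infer_instance

theorem orbit_sum (f : Fin n → Fin n → Fin n → ℚ) (hf : ∀ i j k, f j k i = f i j k) :
    ∑ i, ∑ j, ∑ k, f i j k =
      3 * (∑ i, ∑ j, ∑ k, if isRep i j k then f i j k else 0) + ∑ i, f i i i := by
  have e : ∀ i j k, f i j k = (if isRep i j k then f i j k else 0) +
      (if isRep j k i then f j k i else 0) + (if isRep k i j then f k i j else 0) +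
      (if i = j then (if i = k then f i j k else 0) else 0) := by
    intro i j k
    rw [hf i j k, ← hf k i j]
    generalize f i j k = v
    simp only [isRep, Fin.le_def, Fin.lt_def, Fin.ext_iff]
    split_ifs <;> first | omega | simp
  have h2 := sum_cyc (fun i j k => if isRep i j k then f i j k else 0)
  have h3 := sum_cyc (fun i j k => if isRep k i j then f k i j else 0)
  have h4 : ∑ i, ∑ j, ∑ k, (if i = j then (if i = k then f i j k else 0) else 0) =
      ∑ i, f i i i := by
    simp
  rw [Finset.sum_congr rfl fun i _ => Finset.sum_congr rfl fun j _ =>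
    Finset.sum_congr rfl fun k _ => e i j k]
  simp only [Finset.sum_add_distrib]
  rw [h4, h2, ← h3]
  ring

end Aggregation

/-! ### The `44 × 44` algorithm -/

/-- The representatives as a finset. -/
def reps (n : ℕ) : Finset (Fin n × Fin n × Fin n) :=
  Finset.univ.filter fun p => isRep p.1 p.2.1 p.2.2

theorem sum_reps {n : ℕ} (f : Fin n → Fin n → Fin n → ℚ) :
    (∑ i, ∑ j, ∑ k, if isRep i j k then f i j k else 0) =
      ∑ p ∈ reps n, f p.1 p.2.1 p.2.2 := by
  rw [reps, Finset.sum_filter, Fintype.sum_prod_type]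
  refine Finset.sum_congr rfl fun i _ => ?_
  rw [Fintype.sum_prod_type]

theorem card_reps (n : ℕ) : 3 * (reps n).card + n = n ^ 3 := by
  have h := orbit_sum (n := n) (fun _ _ _ => 1) (fun _ _ _ => rfl)
  rw [sum_reps (fun _ _ _ => 1)] at h
  simp at h
  have h' : ((3 * (reps n).card + n : ℕ) : ℚ) = ((n ^ 3 : ℕ) : ℚ) := by
    push_cast
    rw [← h]
    ring
  exact_mod_cast h'

theorem card_reps_23 : (reps 23).card = 4048 := by
  have := card_reps 23
  omega

theorem rk_agg8 {n : ℕ} (i j k : Fin n) : Rk (fun a b c : Blk n => agg8 a b c i j k) 8 := by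
  have key : ∀ x y z : Fin 2, Rk (fun a b c : Blk n =>
      agg x y z (ent i j a) (ent j k a) (ent k i a)
        (ent i j b) (ent j k b) (ent k i b) (ent i j c) (ent j k c) (ent k i c)) 1 := by
    intro x y z
    let ev : Fin 2 → Fin 2 → Fin n → Fin n → (Blk n →ₗ[ℚ] ℚ) := fun x y i j =>
      LinearMap.proj y ∘ₗ LinearMap.proj x ∘ₗ ent i j
    refine (Rk.one
      ((-1 : ℚ) ^ (z : ℕ) • ev x y i j + (-1 : ℚ) ^ (y : ℕ) • ev z x j k +
        (-1 : ℚ) ^ (x : ℕ) • ev y z k i)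
      ((-1 : ℚ) ^ (z : ℕ) • ev y z j k + (-1 : ℚ) ^ (y : ℕ) • ev x y k i +
        (-1 : ℚ) ^ (x : ℕ) • ev z x i j)
      (ev z x k i + ev y z i j + ev x y j k)).congr fun a b c => ?_
    simp [agg, ev]
  have := Rk.sum (Finset.univ : Finset (Fin 2 × Fin 2 × Fin 2))
    (T := fun p a b c => agg p.1 p.2.1 p.2.2 (ent i j a) (ent j k a) (ent k i a)
        (ent i j b) (ent j k b) (ent k i b) (ent i j c) (ent j k c) (ent k i c))
    (fun p _ => key p.1 p.2.1 p.2.2)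
  have hc : (Finset.univ : Finset (Fin 2 × Fin 2 × Fin 2)).card * 1 = 8 := by simp
  rw [hc] at this
  refine this.congr fun a b c => ?_
  simp only [agg8, Fintype.sum_prod_type]

/-- The explicit tensor of rank `36110`. -/
def bigT (a b c : Blk 23) : ℚ :=
  (∑ p ∈ reps 23, agg8 a b c p.1 p.2.1 p.2.2) +
  (∑ p ∈ (Finset.univ : Finset (Fin 23)).offDiag,
    (-23) * corr (ent p.1 p.2 a) (ent p.1 p.2 b) (ent p.1 p.2 c)) +
  ∑ i, ((1 / 3) * agg8 a b c i i i + (-23) * corr (ent i i a) (ent i i b) (ent i i c))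

theorem rk_bigT : Rk bigT 36110 := by
  have h1 := Rk.sum (reps 23) (T := fun p a b c => agg8 a b c p.1 p.2.1 p.2.2)
    (fun p _ => rk_agg8 p.1 p.2.1 p.2.2)
  have h2 := Rk.sum ((Finset.univ : Finset (Fin 23)).offDiag)
    (T := fun p a b c => (-23) * corr (ent p.1 p.2 a) (ent p.1 p.2 b) (ent p.1 p.2 c))
    (fun p _ => (rk_corr (-23)).comp (ent p.1 p.2) (ent p.1 p.2) (ent p.1 p.2))
  have h3 := Rk.sum (Finset.univ : Finset (Fin 23))
    (T := fun i a b c => (1 / 3) * agg8 a b c i i i +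
      (-23) * corr (ent i i a) (ent i i b) (ent i i c))
    (fun i _ => rk_diag.comp (ent i i) (ent i i) (ent i i))
  have h := (h1.add h2).add h3
  have hn : (reps 23).card * 8 + (Finset.univ : Finset (Fin 23)).offDiag.card * 7 +
      (Finset.univ : Finset (Fin 23)).card * 8 = 36110 := by
    rw [card_reps_23, Finset.offDiag_card]
    simp
  rw [hn] at h
  exact h

theorem bigT_eq (a b c : Blk 23) (ha : ∀ x y, ZS (a x y)) (hb : ∀ x y, ZS (b x y))
    (hc : ∀ x y, ZS (c x y)) :
    ∑ x, ∑ y, ∑ z, tD (a x y) (b y z) (c z x) = bigT a b c := by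
  rw [agg_main a b c ha hb hc, orbit_sum _ (agg8_cyc a b c), sum_reps, bigT]
  have h : ∀ g : Fin 23 → Fin 23 → ℚ, ∑ i, ∑ j, g i j =
      ∑ p ∈ (Finset.univ : Finset (Fin 23)).offDiag, g p.1 p.2 + ∑ i, g i i := by
    intro g
    rw [← Finset.sum_product', ← Finset.diag_union_offDiag, Finset.sum_union
      (Finset.disjoint_diag_offDiag _), Finset.sum_diag, add_comm]
  rw [h (fun i j => corr (ent i j a) (ent i j b) (ent i j c))]
  rw [← Finset.mul_sum, Finset.sum_add_distrib, ← Finset.mul_sum, ← Finset.mul_sum]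
  push_cast
  ring

/-- Embedding of `ℚ²²` as the zero-sum vectors in `ℚ²³`. -/
def matP (n : ℕ) : Matrix (Fin (n + 1)) (Fin n) ℚ :=
  fun i j => Fin.lastCases (motive := fun _ => ℚ) (-1) (fun i' => if i' = j then 1 else 0) i

/-- Left inverse of `matP` killing constants. -/
def matQ (n : ℕ) : Matrix (Fin n) (Fin (n + 1)) ℚ :=
  fun i j => (if j = i.castSucc then 1 else 0) - 1 / (n + 1)

theorem matP_sum (n : ℕ) (j : Fin n) : ∑ i, matP n i j = 0 := by
  simp [matP, Fin.sum_univ_castSucc]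

theorem matQ_sum (n : ℕ) (i : Fin n) : ∑ j, matQ n i j = 0 := by
  have : (n : ℚ) + 1 ≠ 0 := by positivity
  simp [matQ, this]

theorem matQP (n : ℕ) : matQ n * matP n = 1 := by
  ext i j
  rw [Matrix.mul_apply]
  simp only [matQ, sub_mul, Finset.sum_sub_distrib, ← Finset.mul_sum, matP_sum]
  simp [matP, Matrix.one_apply]

/-- The zero-sum version of a block matrix. -/
def emb (n : ℕ) : Blk n →ₗ[ℚ] Blk (n + 1) where
  toFun a := fun x y => matP n * a x y * matQ n
  map_add' a b := by ext x y : 2; simp [Matrix.mul_add, Matrix.add_mul]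
  map_smul' r a := by ext x y : 2; simp

theorem emb_zs (n : ℕ) (a : Blk n) (x y : Fin 2) : ZS (emb n a x y) := by
  constructor
  · intro i
    change ∑ j, (matP n * a x y * matQ n) i j = 0
    simp only [Matrix.mul_apply (M := matP n * a x y)]
    rw [Finset.sum_comm]
    simp [← Finset.mul_sum, matQ_sum]
  · intro j
    change ∑ i, (matP n * a x y * matQ n) i j = 0
    simp only [Matrix.mul_assoc (matP n), Matrix.mul_apply (M := matP n)]
    rw [Finset.sum_comm]
    simp [← Finset.sum_mul, matP_sum]

theorem tD_eq_trace {n : ℕ} (A B C : Matrix (Fin n) (Fin n) ℚ) :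
    tD A B C = (A * B * C).trace := by
  simp only [tD, Matrix.trace, Matrix.diag, Matrix.mul_apply, Finset.sum_mul]
  exact Finset.sum_congr rfl fun i _ => Finset.sum_comm

theorem tD_emb {n : ℕ} (A B C : Matrix (Fin n) (Fin n) ℚ) :
    tD (matP n * A * matQ n) (matP n * B * matQ n) (matP n * C * matQ n) = tD A B C := by
  rw [tD_eq_trace, tD_eq_trace]
  have : matP n * A * matQ n * (matP n * B * matQ n) * (matP n * C * matQ n) =
      matP n * (A * (matQ n * matP n) * B * (matQ n * matP n) * C * matQ n) := by
    simp only [Matrix.mul_assoc]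
  rw [this, Matrix.trace_mul_comm, matQP, Matrix.mul_assoc _ (matQ n), matQP]
  simp

theorem rk_44 : Rk (fun a b c : Blk 22 => ∑ x, ∑ y, ∑ z, tD (a x y) (b y z) (c z x)) 36110 := by
  refine (rk_bigT.comp (emb 22) (emb 22) (emb 22)).congr fun a b c => ?_
  rw [← bigT_eq _ _ _ (emb_zs 22 a) (emb_zs 22 b) (emb_zs 22 c)]
  simp only [emb, LinearMap.coe_mk, AddHom.coe_mk, tD_emb]

/-! ### Composition with Strassen's algorithm -/

theorem rk_compose {M : Type*} [AddCommGroup M] [Module ℚ M] {T : M → M → M → ℚ} {t : ℕ}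
    (H : Rk T t) : Rk (fun a b c : Fin 2 → Fin 2 → M =>
      ∑ u, ∑ v, ∑ w, T (a u v) (b v w) (c w u)) (t * 7) := by
  obtain ⟨f, g, h, H⟩ := H
  let L : (M →ₗ[ℚ] ℚ) → ((Fin 2 → Fin 2 → M) →ₗ[ℚ] Q2) := fun φ =>
    { toFun := fun a u v => φ (a u v)
      map_add' := fun a b => by ext u v; simp
      map_smul' := fun r a => by ext u v; simp }
  have h1 := Rk.sum (Finset.univ : Finset (Fin t))
    (T := fun r a b c => ∑ u, ∑ v, ∑ w, L (f r) a u v * L (g r) b v w * L (h r) c w u)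
    (fun r _ => strassen.comp (L (f r)) (L (g r)) (L (h r)))
  rw [Finset.card_univ, Fintype.card_fin] at h1
  refine h1.congr fun a b c => ?_
  simp only [H, Fin.sum_univ_two, Finset.sum_add_distrib, L, LinearMap.coe_mk, AddHom.coe_mk]

/-- The index bijection. -/
def idx : Fin 2 × Fin 2 × Fin 22 ≃ Fin 88 :=
  ((Equiv.refl (Fin 2)).prodCongr (finProdFinEquiv (m := 2) (n := 22))).trans
    (finProdFinEquiv (m := 2) (n := 44))

/-- Splitting a vectorized matrix into blocks. -/
def split : (Fin (88 * 88) → ℚ) →ₗ[ℚ] (Fin 2 → Fin 2 → Blk 22) where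
  toFun v := fun p q x y i j => v (finProdFinEquiv (idx (p, x, i), idx (q, y, j)))
  map_add' a b := rfl
  map_smul' r a := rfl

theorem split_vec (A : Matrix (Fin 88) (Fin 88) ℚ) (p q x y : Fin 2) (i j : Fin 22) :
    split (vec A) p q x y i j = A (idx (p, x, i)) (idx (q, y, j)) := by
  change A (finProdFinEquiv.symm (finProdFinEquiv (idx (p, x, i), idx (q, y, j)))).1
    (finProdFinEquiv.symm (finProdFinEquiv (idx (p, x, i), idx (q, y, j)))).2 = _
  rw [Equiv.symm_apply_apply]

theorem sum88 (F : Fin 88 → ℚ) : ∑ i, F i = ∑ u, ∑ x, ∑ i, F (idx (u, x, i)) := by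
  rw [← idx.sum_comp, Fintype.sum_prod_type]
  exact Finset.sum_congr rfl fun u _ => Fintype.sum_prod_type _

theorem sum_reorder (G : Fin 2 → Fin 2 → Fin 22 → Fin 2 → Fin 2 → Fin 22 →
      Fin 2 → Fin 2 → Fin 22 → ℚ) :
    ∑ u, ∑ x, ∑ i, ∑ v, ∑ y, ∑ j, ∑ w, ∑ z, ∑ k, G u x i v y j w z k =
    ∑ u, ∑ v, ∑ w, ∑ x, ∑ y, ∑ z, ∑ i, ∑ j, ∑ k, G u x i v y j w z k := by
  simp only [Fin.sum_univ_two, Finset.sum_add_distrib]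
  ring

theorem trace_eq (A B C : Matrix (Fin 88) (Fin 88) ℚ) :
    (A * B * C).trace = ∑ u, ∑ v, ∑ w, ∑ x, ∑ y, ∑ z,
      tD (split (vec A) u v x y) (split (vec B) v w y z) (split (vec C) w u z x) := by
  rw [← tD_eq_trace]
  simp only [tD, split_vec]
  rw [← sum_reorder (fun u x i v y j w z k => A (idx (u, x, i)) (idx (v, y, j)) *
    B (idx (v, y, j)) (idx (w, z, k)) * C (idx (w, z, k)) (idx (u, x, i)))]
  rw [sum88]
  refine Finset.sum_congr rfl fun u _ => Finset.sum_congr rfl fun x _ =>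
    Finset.sum_congr rfl fun i _ => ?_
  rw [sum88]
  refine Finset.sum_congr rfl fun v _ => Finset.sum_congr rfl fun y _ =>
    Finset.sum_congr rfl fun j _ => ?_
  rw [sum88]

theorem main_exists : ∃ (U V W : Matrix (Fin 252770) (Fin (88 * 88)) ℚ),
      IsMMAlg 88 88 88 252770 U V W := by
  obtain ⟨f, g, h, H⟩ := (rk_compose rk_44).comp split split split
  refine ⟨fun r => LinearMap.toMatrix' (LinearMap.pi f) r,
    fun r => LinearMap.toMatrix' (LinearMap.pi g) r,
    fun r => LinearMap.toMatrix' (LinearMap.pi h) r, fun A B C => ?_⟩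
  rw [trace_eq]
  refine (H (vec A) (vec B) (vec C)).trans ?_
  refine Finset.sum_congr rfl fun r _ => ?_
  have e : ∀ (φ : Fin 252770 → (Fin (88 * 88) → ℚ) →ₗ[ℚ] ℚ) (v : Fin (88 * 88) → ℚ),
      (LinearMap.toMatrix' (LinearMap.pi φ)).mulVec v r = φ r v := by
    intro φ v
    rw [LinearMap.toMatrix'_mulVec]
    rfl
  exact (congrArg₂ (· * ·) (congrArg₂ (· * ·) (e f _) (e g _)) (e h _)).symm

/-- There exists an `⟨88,88,88;252770⟩`-algorithm over `ℚ` (from composing a `⟨2,2,2;7⟩`-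
and a `⟨44,44,44;36110⟩`-algorithm); in particular `252770 < 257100`, the multiplication
count of the TA-New25 algorithm with base case `88`. -/
theorem exists_88_88_88_252770_algorithm :
    (∃ (U V W : Matrix (Fin 252770) (Fin (88 * 88)) ℚ),
      IsMMAlg 88 88 88 252770 U V W) ∧ 252770 < 257100 := by
  exact ⟨main_exists, by norm_num⟩
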